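/- Fix ε ∈ (0,1) and x₀ ∈ ℝ, and let Ω = ℝ × (0, 1/√(1 − ε²)). Define g, f : Ω → ℝ by g(x,y) = (1 − ε²)·(x − x₀) − √(1 − (1 − ε²)·y²) and f(x,y) = −x + √(1 − (1 − ε²)·y²) − artanh(√(1 − (1 − ε²)·y²)). Then at every point of Ω: (i) ∇f·∇g = 0, and (ii) ‖∇f(x,y)‖ = √(ε² + 1/y²). -/

import Mathlib

open Set

/-- Euclidean norm of a vector in `ℝ × ℝ`. -/
noncomputable def elen (v : ℝ × ℝ) : ℝ := Real.sqrt (v.1 ^ 2 + v.2 ^ 2)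

/-- Euclidean dot product on `ℝ × ℝ`. -/
def dotp (v w : ℝ × ℝ) : ℝ := v.1 * w.1 + v.2 * w.2

/-- The gradient `(u_x, u_y)` of `u : ℝ × ℝ → ℝ` at a point. -/
noncomputable def grad (u : ℝ × ℝ → ℝ) (p : ℝ × ℝ) : ℝ × ℝ :=
  (fderiv ℝ u p (1, 0), fderiv ℝ u p (0, 1))

/-- Real inverse hyperbolic tangent: `artanh s = (1/2)·ln((1+s)/(1−s))`. -/
noncomputable def artanh (s : ℝ) : ℝ := (1 / 2) * Real.log ((1 + s) / (1 - s))

theorem grad_sep (F : ℝ × ℝ → ℝ) (a b : ℝ → ℝ) (da db : ℝ) (p : ℝ × ℝ)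
    (hF : F = fun w => a w.1 + b w.2)
    (ha : HasDerivAt a da p.1) (hb : HasDerivAt b db p.2) : grad F p = (da, db) := by
  subst hF
  have h1 : HasFDerivAt (fun w : ℝ × ℝ => a w.1) (da • ContinuousLinearMap.fst ℝ ℝ ℝ) p :=
    ha.comp_hasFDerivAt p hasFDerivAt_fst
  have h2 : HasFDerivAt (fun w : ℝ × ℝ => b w.2) (db • ContinuousLinearMap.snd ℝ ℝ ℝ) p :=
    hb.comp_hasFDerivAt p hasFDerivAt_snd
  have h3 := (h1.add h2).fderiv
  have h4 : fderiv ℝ (fun w : ℝ × ℝ => a w.1 + b w.2) p =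
      da • ContinuousLinearMap.fst ℝ ℝ ℝ + db • ContinuousLinearMap.snd ℝ ℝ ℝ := h3
  simp [grad, h4]

theorem hasDerivAt_artanh_aux (s : ℝ) (h0 : 0 < s) (h1 : s < 1) :
    HasDerivAt artanh (1 / (1 - s ^ 2)) s := by
  have hm : 1 - s ≠ 0 := by linarith
  have hpl : 1 + s ≠ 0 := by linarith
  have hsq : 1 - s ^ 2 ≠ 0 := by nlinarith
  have hd := ((((hasDerivAt_id s).const_add 1).div ((hasDerivAt_id s).const_sub 1) hm).log
    (div_ne_zero hpl hm)).const_mul (1 / 2)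
  refine HasDerivAt.congr_deriv (f := artanh) hd ?_
  have e : 1 - s ^ 2 = (1 - s) * (1 + s) := by ring
  rw [e]
  simp only [id, Pi.div_apply]
  field_simp
  ring

/-- the calibration pair for the conic-section density with
`ε ∈ (0,1)`. On `Ω = ℝ × (0, 1/√(1 − ε²))`, with
`g(x,y) = (1 − ε²)(x − x₀) − √(1 − (1 − ε²)y²)` and
`f(x,y) = −x + √(1 − (1 − ε²)y²) − artanh(√(1 − (1 − ε²)y²))`,
one has `∇f·∇g = 0` and `‖∇f‖ = √(ε² + 1/y²)`. -/
theorem statement13 (ε x₀ : ℝ) (hε : ε ∈ Ioo (0:ℝ) 1) (p : ℝ × ℝ)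
    (hp : p ∈ (univ : Set ℝ) ×ˢ Ioo 0 (1 / Real.sqrt (1 - ε ^ 2))) :
    dotp (grad (fun w : ℝ × ℝ => -w.1 + Real.sqrt (1 - (1 - ε ^ 2) * w.2 ^ 2)
            - artanh (Real.sqrt (1 - (1 - ε ^ 2) * w.2 ^ 2))) p)
        (grad (fun w : ℝ × ℝ => (1 - ε ^ 2) * (w.1 - x₀)
            - Real.sqrt (1 - (1 - ε ^ 2) * w.2 ^ 2)) p) = 0 ∧
    elen (grad (fun w : ℝ × ℝ => -w.1 + Real.sqrt (1 - (1 - ε ^ 2) * w.2 ^ 2)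
            - artanh (Real.sqrt (1 - (1 - ε ^ 2) * w.2 ^ 2))) p)
      = Real.sqrt (ε ^ 2 + 1 / p.2 ^ 2) := by
  obtain ⟨he0, he1⟩ := hε
  obtain ⟨-, hy0, hy1⟩ := hp
  have hk : 0 < 1 - ε ^ 2 := by nlinarith
  have hky : (1 - ε ^ 2) * p.2 ^ 2 < 1 := by
    rw [lt_div_iff₀ (Real.sqrt_pos.2 hk)] at hy1
    have h := Real.sq_sqrt hk.le
    have hpos : 0 < p.2 * Real.sqrt (1 - ε ^ 2) := mul_pos hy0 (Real.sqrt_pos.2 hk)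
    have : (p.2 * Real.sqrt (1 - ε ^ 2)) ^ 2 < 1 := by nlinarith
    rw [mul_pow, h] at this
    linarith
  have hkp : 0 < (1 - ε ^ 2) * p.2 ^ 2 := by positivity
  obtain ⟨s, hs⟩ : ∃ s, s = Real.sqrt (1 - (1 - ε ^ 2) * p.2 ^ 2) := ⟨_, rfl⟩
  have hs0 : 0 < s := by rw [hs]; exact Real.sqrt_pos.2 (by linarith)
  have hs2 : s ^ 2 = 1 - (1 - ε ^ 2) * p.2 ^ 2 := by rw [hs]; exact Real.sq_sqrt (by linarith)
  have hs1 : s < 1 := by nlinarith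
  have hS : HasDerivAt (fun y : ℝ => Real.sqrt (1 - (1 - ε ^ 2) * y ^ 2))
      (-((1 - ε ^ 2) * p.2 / s)) p.2 := by
    have h := ((((hasDerivAt_id p.2).pow 2).const_mul (1 - ε ^ 2)).const_sub 1).sqrt
      (by simp only [id, Pi.pow_apply]; linarith)
    refine HasDerivAt.congr_deriv h ?_
    simp only [id, Pi.pow_apply, ← hs]
    field_simp
    norm_num
  have hA : HasDerivAt (fun y : ℝ => artanh (Real.sqrt (1 - (1 - ε ^ 2) * y ^ 2)))
      (1 / (1 - s ^ 2) * (-((1 - ε ^ 2) * p.2 / s))) p.2 := by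
    have h := hasDerivAt_artanh_aux s hs0 hs1
    rw [hs] at h
    rw [hs]
    rw [hs] at hS
    have h3 := HasDerivAt.comp (h₂ := artanh) p.2 h hS
    exact h3
  have hf : grad (fun w : ℝ × ℝ => -w.1 + Real.sqrt (1 - (1 - ε ^ 2) * w.2 ^ 2)
            - artanh (Real.sqrt (1 - (1 - ε ^ 2) * w.2 ^ 2))) p = (-1, s / p.2) := by
    refine grad_sep _ (fun x => -x) (fun y => Real.sqrt (1 - (1 - ε ^ 2) * y ^ 2)
      - artanh (Real.sqrt (1 - (1 - ε ^ 2) * y ^ 2))) _ _ p ?_ (hasDerivAt_neg _)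
      (HasDerivAt.congr_deriv (hS.sub hA) ?_)
    · funext w; ring
    · have e : 1 - s ^ 2 = (1 - ε ^ 2) * p.2 ^ 2 := by linarith
      rw [e]
      have := ne_of_gt hk
      field_simp
      linarith
  have hg : grad (fun w : ℝ × ℝ => (1 - ε ^ 2) * (w.1 - x₀)
            - Real.sqrt (1 - (1 - ε ^ 2) * w.2 ^ 2)) p
      = (1 - ε ^ 2, (1 - ε ^ 2) * p.2 / s) := by
    refine grad_sep _ (fun x => (1 - ε ^ 2) * (x - x₀))
      (fun y => -Real.sqrt (1 - (1 - ε ^ 2) * y ^ 2)) _ _ p ?_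
      (HasDerivAt.congr_deriv (((hasDerivAt_id p.1).sub_const x₀).const_mul (1 - ε ^ 2)) ?_)
      (HasDerivAt.congr_deriv hS.neg ?_)
    · funext w; ring
    · ring
    · ring
  rw [hf, hg]
  constructor
  · simp only [dotp]
    field_simp
    ring
  · simp only [elen]
    congr 1
    rw [div_pow, hs2]
    field_simp
    ring
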